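/- Let π ∈ S, τ^π = τ_{F^π}, s ≥ 1, let 𝐧 ∈ ℕ₀^d with 𝐧 < 2^{2m_s+1}𝟏, and let Δ be a dyadic cube of rank m_s with Δ ⊆ F̃^π_{s−1}. Then the Haar integral of W_𝐧 over F_s^π ∩ Δ satisfies ∫_{F_s^π ∩ Δ} W_𝐧 dμ = 2^{−s} · (τ^π)̂_𝐧(Δ). In particular this holds for τ = τ_F, F_s, F̃_{s−1} (identity permutations). -/

import Mathlib

open Filter Finset Topology MeasureTheory
open scoped Classical

noncomputable section

instance : TopologicalSpace (ZMod 2) := ⊥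
instance : DiscreteTopology (ZMod 2) := ⟨rfl⟩

/-- The dyadic (Cantor) group `𝔾`: sequences of elements of `ℤ/2ℤ`
with coordinatewise addition modulo 2, Tychonoff topology. -/
abbrev DyadicGroup : Type := ℕ → ZMod 2

instance : MeasurableSpace DyadicGroup := borel _
instance : BorelSpace DyadicGroup := ⟨rfl⟩

/-- `𝔾^d`. -/
abbrev GD (d : ℕ) : Type := Fin d → DyadicGroup

/-- One-dimensional Walsh function `W_n` in the Paley enumeration:
`W_n(g) = ∏_k (-1)^(g_k n_k)`. -/
def walsh (n : ℕ) (g : DyadicGroup) : ℝ :=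
  ∏ k ∈ Finset.range n, if n.testBit k ∧ g k = 1 then (-1 : ℝ) else 1

/-- `d`-dimensional Walsh function `W_𝐧(𝐠) = ∏ W_{n^l}(g^l)`. -/
def walshD {d : ℕ} (n : Fin d → ℕ) (g : GD d) : ℝ :=
  ∏ l, walsh (n l) (g l)

/-- The dyadic interval `Δ^{(k)}_m` of rank `k`. -/
def dyadicInterval (k m : ℕ) : Set DyadicGroup :=
  {g | ∀ t < k, g t = if m.testBit (k - 1 - t) then 1 else 0}

/-- The dyadic cube `Δ^{(k)}_𝐦 = Δ^{(k)}_{m^1} × ⋯ × Δ^{(k)}_{m^d}`. -/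
def dyadicCube {d : ℕ} (k : ℕ) (m : Fin d → ℕ) : Set (GD d) :=
  {g | ∀ l, g l ∈ dyadicInterval k (m l)}

/-- The canonical point of `Δ^{(k)}_m`. -/
def intervalPoint (k m : ℕ) : DyadicGroup :=
  fun t => if t < k ∧ m.testBit (k - 1 - t) then 1 else 0

/-- The canonical point of `Δ^{(k)}_𝐦`. -/
def cubePoint {d : ℕ} (k : ℕ) (m : Fin d → ℕ) : GD d :=
  fun l => intervalPoint k (m l)

/-- `W^{(k)}_{n,m}`: the (constant, for `n < 2^k`) value of `W_n` on `Δ^{(k)}_m`. -/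
def walshVal (k n m : ℕ) : ℝ := walsh n (intervalPoint k m)

/-- `W^{(k)}_{𝐧𝐦}`: the (constant, for `𝐧 < 2^k·𝟏`) value of `W_𝐧` on `Δ^{(k)}_𝐦`. -/
def walshValD {d : ℕ} (k : ℕ) (n m : Fin d → ℕ) : ℝ := walshD n (cubePoint k m)

/-- The box `{𝐧 : 𝐧 < 𝐍}` as a finset. -/
def boxLt {d : ℕ} (N : Fin d → ℕ) : Finset (Fin d → ℕ) :=
  Fintype.piFinset fun l => Finset.range (N l)

/-- The box `{0,…,2^k−1}^d` as a set. -/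
def box (d k : ℕ) : Set (Fin d → ℕ) := {m | ∀ l, m l < 2 ^ k}

/-- The rectangular partial sum `S_𝐍(𝐠)` of the Walsh series with coefficients `a`. -/
def walshPartialSum {d : ℕ} (a : (Fin d → ℕ) → ℂ) (N : Fin d → ℕ) (g : GD d) : ℂ :=
  ∑ n ∈ boxLt N, a n * (walshD n g : ℂ)

/-- Convergence over rectangles: `S_𝐍(𝐠) → S` as `min_j N^j → ∞`. -/
def ConvergesOverRectangles {d : ℕ} (a : (Fin d → ℕ) → ℂ) (g : GD d) (S : ℂ) : Prop :=
  Tendsto (fun N : Fin d → ℕ => walshPartialSum a N g) atTop (𝓝 S)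

/-- Convergence over cubes: `S_{N𝟏}(𝐠) → S` as `N → ∞`. -/
def ConvergesOverCubes {d : ℕ} (a : (Fin d → ℕ) → ℂ) (g : GD d) (S : ℂ) : Prop :=
  Tendsto (fun N : ℕ => walshPartialSum a (fun _ => N) g) atTop (𝓝 S)

/-- `λ`-convergence: `S_𝐍(𝐠) → S` as `min_j N^j → ∞` along `𝐍` with `max N^j/N^k ≤ λ`. -/
def LambdaConverges {d : ℕ} (lam : ℝ) (a : (Fin d → ℕ) → ℂ) (g : GD d) (S : ℂ) : Prop :=
  ∀ ε : ℝ, 0 < ε → ∃ K : ℕ, ∀ N : Fin d → ℕ, (∀ j, K ≤ N j) →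
    (∀ j k, (N j : ℝ) ≤ lam * N k) → ‖walshPartialSum a N g - S‖ < ε

/-- Auxiliary predicate for iterated summation of a multiple series with terms `f`;
the list gives the order of summation, *innermost index first*.  After summing the
series in the variables of the list, the remaining (partially summed) function is `g`. -/
def IterConvAux {d : ℕ} : List (Fin d) → ((Fin d → ℕ) → ℂ) → ((Fin d → ℕ) → ℂ) → Prop
  | [], f, g => f = g
  | j :: rest, f, g => ∃ h : (Fin d → ℕ) → ℂ,
      (∀ n, Tendsto (fun T : ℕ => ∑ t ∈ Finset.range T, f (Function.update n j t))
        atTop (𝓝 (h n))) ∧ IterConvAux rest h g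

/-- The multiple series with terms `f` converges iteratedly to `S`, the order of
summation being given by the list `l` (innermost index first): all successively
nested inner series converge and the full iterated sum equals `S`. -/
def IterConverges {d : ℕ} (l : List (Fin d)) (f : (Fin d → ℕ) → ℂ) (S : ℂ) : Prop :=
  ∃ g, IterConvAux l f g ∧ ∀ n, g n = S

/-- `A` is an M-set for the `d`-dimensional Walsh system under rectangular convergence. -/
def IsMSetRect {d : ℕ} (A : Set (GD d)) : Prop :=
  ∃ a : (Fin d → ℕ) → ℂ, (∃ n, a n ≠ 0) ∧ ∀ g ∉ A, ConvergesOverRectangles a g 0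

/-- `A` is an M-set for the `d`-dimensional Walsh system under convergence over cubes. -/
def IsMSetCubes {d : ℕ} (A : Set (GD d)) : Prop :=
  ∃ a : (Fin d → ℕ) → ℂ, (∃ n, a n ≠ 0) ∧ ∀ g ∉ A, ConvergesOverCubes a g 0

/-- `A` is an M-set under iterated convergence with summation order `l` (innermost first). -/
def IsMSetIter {d : ℕ} (A : Set (GD d)) (l : List (Fin d)) : Prop :=
  ∃ a : (Fin d → ℕ) → ℂ, (∃ n, a n ≠ 0) ∧
    ∀ g ∉ A, IterConverges l (fun n => a n * (walshD n g : ℂ)) 0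

/-- `A` is an M-set for the `d`-dimensional Walsh system under `λ`-convergence. -/
def IsMSetLambda {d : ℕ} (lam : ℝ) (A : Set (GD d)) : Prop :=
  ∃ a : (Fin d → ℕ) → ℂ, (∃ n, a n ≠ 0) ∧ ∀ g ∉ A, LambdaConverges lam a g 0

/-- A quasimeasure: a finitely additive function on dyadic cubes (indexed by rank
`k` and position `𝐦 < 2^k·𝟏`). -/
def IsQuasimeasure {d : ℕ} (τ : ℕ → (Fin d → ℕ) → ℂ) : Prop :=
  ∀ k m, (∀ l, m l < 2 ^ k) →
    τ k m = ∑ σ : Fin d → Fin 2, τ (k + 1) fun l => 2 * m l + (σ l : ℕ)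

/-- The quasimeasure generated by the Walsh series with coefficients `a`:
`τ(Δ^{(k)}_𝐦) = 2^{-kd} ∑_{𝐧<2^k𝟏} a_𝐧 W_𝐧(Δ^{(k)}_𝐦)`. -/
def genQM {d : ℕ} (a : (Fin d → ℕ) → ℂ) (k : ℕ) (m : Fin d → ℕ) : ℂ :=
  ((2 : ℂ) ^ (k * d))⁻¹ * ∑ n ∈ boxLt (fun _ : Fin d => 2 ^ k), a n * (walshValD k n m : ℂ)

/-- The Fourier–Walsh coefficient `τ̂_𝐧` of a quasimeasure `τ`, computed at resolution `k`
(the value does not depend on `k` as long as `𝐧 < 2^k𝟏`). -/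
def fourierCoeffAt {d : ℕ} (τ : ℕ → (Fin d → ℕ) → ℂ) (n : Fin d → ℕ) (k : ℕ) : ℂ :=
  ∑ m ∈ boxLt (fun _ : Fin d => 2 ^ k), (walshValD k n m : ℂ) * τ k m

/-- The local Fourier–Walsh coefficient `τ̂_𝐧(Δ^{(r)}_{𝐦Δ})`, computed at resolution `k ≥ r`. -/
def localCoeffAt {d : ℕ} (τ : ℕ → (Fin d → ℕ) → ℂ) (n : Fin d → ℕ)
    (r : ℕ) (mΔ : Fin d → ℕ) (k : ℕ) : ℂ :=
  ∑ m ∈ (boxLt (fun _ : Fin d => 2 ^ k)).filter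
      (fun m => dyadicCube k m ⊆ dyadicCube r mΔ),
    (walshValD k n m : ℂ) * τ k m

/-- The support of a quasimeasure: the complement of the union of all dyadic cubes `Δ₀`
such that `τ(Δ) = 0` for every dyadic cube `Δ ⊆ Δ₀`. -/
def qmSupport {d : ℕ} (τ : ℕ → (Fin d → ℕ) → ℂ) : Set (GD d) :=
  (⋃ k, ⋃ m ∈ box d k,
    ⋃ (_ : ∀ k' m', (∀ l, m' l < 2 ^ k') →
        dyadicCube k' m' ⊆ dyadicCube k m → τ k' m' = 0),
    dyadicCube k m)ᶜ

/-- The restriction `τ|_{Δ̃}` of a quasimeasure to the dyadic cube `Δ̃ = Δ^{(r)}_{𝐦Δ}`: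
`τ|_{Δ̃}(Δ) = τ(Δ̃ ∩ Δ)` (two dyadic cubes are nested or disjoint). -/
def restrictQM {d : ℕ} (τ : ℕ → (Fin d → ℕ) → ℂ) (r : ℕ) (mΔ : Fin d → ℕ) :
    ℕ → (Fin d → ℕ) → ℂ := fun k m =>
  if dyadicCube k m ⊆ dyadicCube (d := d) r mΔ then τ k m
  else if dyadicCube (d := d) r mΔ ⊆ dyadicCube k m then τ r mΔ
  else 0

/-- `τ` is the canonical quasimeasure `τ_E` associated with a (nonempty closed) set `E`:
`τ(𝔾^d) = 1`; `τ(Δ) = 0` iff `Δ ∩ E = ∅`; and the mass of a cube meeting `E` is divided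
equally among its `2^d` immediate subcubes that meet `E`. -/
def IsTauOf {d : ℕ} (E : Set (GD d)) (τ : ℕ → (Fin d → ℕ) → ℂ) : Prop :=
  IsQuasimeasure τ ∧
  τ 0 (fun _ => 0) = 1 ∧
  (∀ k m, (∀ l, m l < 2 ^ k) → (τ k m = 0 ↔ dyadicCube k m ∩ E = ∅)) ∧
  (∀ k m, (∀ l, m l < 2 ^ k) → (dyadicCube k m ∩ E).Nonempty →
    ∀ σ : Fin d → Fin 2,
      τ (k + 1) (fun l => 2 * m l + (σ l : ℕ)) =
        if (dyadicCube (k + 1) (fun l => 2 * m l + (σ l : ℕ)) ∩ E).Nonempty then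
          τ k m / ((Finset.univ.filter fun σ' : Fin d → Fin 2 =>
              (dyadicCube (k + 1) (fun l => 2 * m l + (σ' l : ℕ)) ∩ E).Nonempty).card : ℂ)
        else 0)

/-- The sequence `m_s`: `m_1 = 0`, `m_{s+1} = 2(2m_s+1)` (value at `0` is junk). -/
def mSeq : ℕ → ℕ
  | 0 => 0
  | s + 1 => if s = 0 then 0 else 2 * (2 * mSeq s + 1)

/-- The layer `F_s^π`. -/
def Fspi {d : ℕ} (π : ℕ → (Fin d → ℕ) → Fin d → ℕ) (s : ℕ) : Set (GD d) :=
  ⋃ m ∈ box d (mSeq s), ⋃ m' ∈ box d (mSeq s),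
    {g | g ∈ dyadicCube (2 * mSeq s) (fun l => 2 ^ mSeq s * m l + m' l) ∧
      walshD (fun _ => 2 ^ (2 * mSeq s)) g = walshValD (mSeq s) (π s m) m'}

/-- `F̃_s^π = F_1^π ∩ ⋯ ∩ F_s^π` (so `F̃_0^π = 𝔾^d`). -/
def Ftil {d : ℕ} (π : ℕ → (Fin d → ℕ) → Fin d → ℕ) (s : ℕ) : Set (GD d) :=
  ⋂ k ∈ Finset.Icc 1 s, Fspi π k

/-- `F^π = ⋂_{s≥1} F_s^π`. -/
def Fpi {d : ℕ} (π : ℕ → (Fin d → ℕ) → Fin d → ℕ) : Set (GD d) :=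
  ⋂ s ∈ Set.Ici 1, Fspi π s

/-- The identity element of `S` (yielding `F_s`, `F̃_s` and `F` themselves). -/
def idPerm (d : ℕ) : ℕ → (Fin d → ℕ) → Fin d → ℕ := fun _ m => m

/-- `S`: sequences `π = (π_s)` of permutations of the boxes `{0,…,2^{m_s}−1}^d`. -/
structure PermSeq (d : ℕ) where
  p : ℕ → Equiv.Perm (Fin d → ℕ)
  maps : ∀ s, Set.MapsTo (p s) (box d (mSeq s)) (box d (mSeq s))

/-- The underlying sequence of functions of an element of `S`. -/
def PermSeq.f {d : ℕ} (π : PermSeq d) : ℕ → (Fin d → ℕ) → Fin d → ℕ := fun s => ⇑(π.p s)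

/-- `π ∈ S'`: every `π_s` acts coordinatewise, `π_s(𝐦) = (π_s^1(m^1),…,π_s^d(m^d))`. -/
def PermSeq.Coordinatewise {d : ℕ} (π : PermSeq d) : Prop :=
  ∀ s, ∃ e : Fin d → ℕ → ℕ, ∀ m : Fin d → ℕ, π.p s m = fun l => e l (m l)

/-- The Dirichlet kernel `D_N = ∑_{n<N} W_n` of the one-dimensional Walsh system. -/
def dirichlet (N : ℕ) (g : DyadicGroup) : ℝ :=
  ∑ n ∈ Finset.range N, walsh n g

/-! ### Auxiliary material -/

def idx : ℕ → DyadicGroup → ℕ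
  | 0, _ => 0
  | k + 1, g => 2 * idx k g + (g k).val

def Agree {d : ℕ} (k : ℕ) (g h : GD d) : Prop := ∀ l, ∀ t < k, g l t = h l t

lemma idx_lt (k : ℕ) (g : DyadicGroup) : idx k g < 2 ^ k := by
  induction k with
  | zero => simp [idx]
  | succ k ih =>
    have := ZMod.val_lt (g k)
    simp only [idx, pow_succ]; omega

lemma zmod2_eq_iff (a : ZMod 2) (m : ℕ) :
    a = (if m.testBit 0 then 1 else 0) ↔ a.val = m % 2 := by
  rcases Nat.mod_two_eq_zero_or_one m with h | h <;> simp [Nat.testBit_zero, h]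
  all_goals (revert a; decide)

lemma mem_interval_iff (k m : ℕ) (hm : m < 2 ^ k) (g : DyadicGroup) :
    g ∈ dyadicInterval k m ↔ idx k g = m := by
  induction k generalizing m with
  | zero =>
    have h0 : m = 0 := by simpa using hm
    simp [dyadicInterval, idx, h0]
  | succ k ih =>
    have h1 : g ∈ dyadicInterval (k+1) m ↔
        g ∈ dyadicInterval k (m/2) ∧ g k = (if m.testBit 0 then 1 else 0) := by
      constructor
      · intro h
        refine ⟨fun t ht => ?_, by simpa using h k (by omega)⟩
        have := h t (by omega)
        rw [this, Nat.testBit_div_two]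
        congr 3; omega
      · rintro ⟨h, h'⟩ t ht
        rcases Nat.lt_succ_iff_lt_or_eq.1 ht with ht | rfl
        · have := h t ht
          rw [this, Nat.testBit_div_two]
          congr 3; omega
        · simpa using h'
    rw [h1, ih (m/2) (by rw [pow_succ] at hm; omega), zmod2_eq_iff]
    have := ZMod.val_lt (g k)
    simp only [idx]; omega

lemma interval_pt_mem (k m : ℕ) : intervalPoint k m ∈ dyadicInterval k m := by
  intro t ht; simp [intervalPoint, ht]

lemma idx_pt (k m : ℕ) (hm : m < 2 ^ k) : idx k (intervalPoint k m) = m :=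
  (mem_interval_iff k m hm _).1 (interval_pt_mem k m)

lemma idx_congr (k : ℕ) (g h : DyadicGroup) (H : ∀ t < k, g t = h t) : idx k g = idx k h := by
  induction k with
  | zero => rfl
  | succ k ih => simp only [idx]; rw [ih (fun t ht => H t (by omega)), H k (by omega)]

lemma agree_of_idx (k : ℕ) (g h : DyadicGroup) (H : idx k g = idx k h) : ∀ t < k, g t = h t := by
  intro t ht
  have h1 := (mem_interval_iff k _ (idx_lt k h) g).2 H
  have h2 := (mem_interval_iff k _ (idx_lt k h) h).2 rfl
  rw [h1 t ht, h2 t ht]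

section Aux

variable {d : ℕ}

lemma Agree.symm {k : ℕ} {g h : GD d} (H : Agree k g h) : Agree k h g :=
  fun l t ht => (H l t ht).symm
lemma Agree.trans {k : ℕ} {g h i : GD d} (H : Agree k g h) (H' : Agree k h i) : Agree k g i :=
  fun l t ht => (H l t ht).trans (H' l t ht)
lemma Agree.mono {j k : ℕ} (hjk : j ≤ k) {g h : GD d} (H : Agree k g h) : Agree j g h :=
  fun l t ht => H l t (by omega)

lemma mem_cube_iff (k : ℕ) (m : Fin d → ℕ) (hm : ∀ l, m l < 2 ^ k) (g : GD d) :
    g ∈ dyadicCube k m ↔ (fun l => idx k (g l)) = m := by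
  constructor
  · intro h; funext l; exact (mem_interval_iff k _ (hm l) _).1 (h l)
  · rintro h l; exact (mem_interval_iff k _ (hm l) _).2 (congrFun h l)

lemma mem_cube_agree (k : ℕ) (m : Fin d → ℕ) (g : GD d) :
    g ∈ dyadicCube k m ↔ Agree k g (cubePoint k m) := by
  constructor
  · intro h l t ht
    rw [h l t ht]; simp [cubePoint, intervalPoint, ht]
  · intro h l t ht
    rw [h l t ht]; simp [cubePoint, intervalPoint, ht]

lemma Agree.mem_cube {k : ℕ} {m : Fin d → ℕ} {g h : GD d} (H : Agree k g h)
    (hg : g ∈ dyadicCube k m) : h ∈ dyadicCube k m := by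
  rw [mem_cube_agree] at *
  exact H.symm.trans hg

lemma pt_mem (k : ℕ) (m : Fin d → ℕ) : cubePoint k m ∈ dyadicCube k m :=
  fun l => interval_pt_mem k (m l)

lemma cube_subset_iff {r k : ℕ} (hrk : r ≤ k) (m mΔ : Fin d → ℕ) :
    dyadicCube k m ⊆ dyadicCube r mΔ ↔ cubePoint k m ∈ dyadicCube r mΔ := by
  constructor
  · intro h; exact h (pt_mem k m)
  · intro h g hg
    rw [mem_cube_agree] at hg
    exact (hg.mono hrk).symm.mem_cube h

lemma walsh_congr (n k : ℕ) (hn : n < 2 ^ k) (g h : DyadicGroup) (H : ∀ t < k, g t = h t) :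
    walsh n g = walsh n h := by
  unfold walsh
  refine Finset.prod_congr rfl fun t _ => ?_
  by_cases ht : t < k
  · rw [H t ht]
  · have : n.testBit t = false :=
      Nat.testBit_lt_two_pow (hn.trans_le (Nat.pow_le_pow_right (by norm_num) (by omega)))
    simp [this]

lemma walshD_congr (n : Fin d → ℕ) (k : ℕ) (hn : ∀ l, n l < 2 ^ k) (g h : GD d)
    (H : Agree k g h) : walshD n g = walshD n h :=
  Finset.prod_congr rfl fun l _ => walsh_congr _ k (hn l) _ _ (H l)

lemma walsh_pm (n : ℕ) (g : DyadicGroup) : walsh n g = 1 ∨ walsh n g = -1 := by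
  unfold walsh
  refine Finset.prod_induction _ (fun x => x = 1 ∨ x = -1) ?_ (Or.inl rfl) ?_
  · rintro a b (rfl | rfl) (rfl | rfl) <;> simp
  · intro t _; split_ifs <;> simp

lemma walshD_pm (n : Fin d → ℕ) (g : GD d) : walshD n g = 1 ∨ walshD n g = -1 := by
  unfold walshD
  refine Finset.prod_induction _ (fun x => x = 1 ∨ x = -1) ?_ (Or.inl rfl) ?_
  · rintro a b (rfl | rfl) (rfl | rfl) <;> simp
  · intro t _; exact walsh_pm _ _

lemma walsh_two_pow (j : ℕ) (g : DyadicGroup) :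
    walsh (2 ^ j) g = if g j = 1 then -1 else 1 := by
  unfold walsh
  rw [Finset.prod_eq_single j]
  · simp [Nat.testBit_two_pow]
  · intro b _ hb
    have : (2 ^ j).testBit b = false := by simp [Nat.testBit_two_pow]; omega
    simp [this]
  · intro h; exact absurd (Finset.mem_range.2 Nat.lt_two_pow_self) h

def flipAt (l0 : Fin d) (j : ℕ) (g : GD d) : GD d :=
  Function.update g l0 (Function.update (g l0) j (g l0 j + 1))

lemma flip_agree (l0 : Fin d) (j : ℕ) (g : GD d) : Agree j (flipAt l0 j g) g := by
  intro l t ht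
  unfold flipAt
  by_cases hl : l = l0
  · subst hl; simp [Function.update_of_ne (show t ≠ j by omega)]
  · simp [Function.update_of_ne hl]

lemma walsh_flip (l0 : Fin d) (j : ℕ) (g : GD d) :
    walshD (fun _ => 2 ^ j) (flipAt l0 j g) = - walshD (fun _ => 2 ^ j) g := by
  unfold walshD
  rw [← Finset.mul_prod_erase _ _ (Finset.mem_univ l0),
    ← Finset.mul_prod_erase _ (fun l => walsh (2^j) (g l)) (Finset.mem_univ l0), ← neg_mul]
  congr 1
  · simp only [walsh_two_pow, flipAt, Function.update_self]
    generalize g l0 j = a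
    have : a = 0 ∨ a = 1 := by revert a; decide
    rcases this with rfl | rfl
    · simp
    · rw [if_neg (by decide)]; simp
  · refine Finset.prod_congr rfl fun l hl => ?_
    simp [flipAt, Function.update_of_ne (Finset.ne_of_mem_erase hl)]

/-- digit condition for the layer -/
lemma Fspi_iff (π : ℕ → (Fin d → ℕ) → Fin d → ℕ) (s : ℕ) (g : GD d) :
    g ∈ Fspi π s ↔ walshD (fun _ => 2 ^ (2 * mSeq s)) g =
      walshValD (mSeq s) (π s (fun l => idx (2 * mSeq s) (g l) / 2 ^ mSeq s))
        (fun l => idx (2 * mSeq s) (g l) % 2 ^ mSeq s) := by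
  set M := mSeq s with hM
  have hpos : 0 < 2 ^ M := by positivity
  unfold Fspi
  rw [← hM]
  simp only [Set.mem_iUnion, Set.mem_setOf_eq, exists_prop]
  constructor
  · rintro ⟨m, hm, m', hm', hg, hw⟩
    rw [mem_cube_iff] at hg
    · have e1 : (fun l => idx (2 * M) (g l) / 2 ^ M) = m := by
        funext l; rw [congrFun hg l, Nat.mul_add_div hpos, Nat.div_eq_of_lt (hm' l), add_zero]
      have e2 : (fun l => idx (2 * M) (g l) % 2 ^ M) = m' := by
        funext l; rw [congrFun hg l, Nat.mul_add_mod, Nat.mod_eq_of_lt (hm' l)]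
      rw [e1, e2, hw]
    · intro l
      have h1 := hm l
      have h2 := hm' l
      rw [two_mul, pow_add]
      calc 2 ^ M * m l + m' l < 2 ^ M * (m l + 1) := by rw [mul_add]; omega
        _ ≤ 2 ^ M * 2 ^ M := Nat.mul_le_mul_left _ h1
  · intro h
    have hb : ∀ l, idx (2 * M) (g l) / 2 ^ M < 2 ^ M := fun l => by
      rw [Nat.div_lt_iff_lt_mul hpos, ← pow_add, ← two_mul]; exact idx_lt _ _
    refine ⟨_, hb, _, fun l => Nat.mod_lt _ hpos, ?_, h⟩
    have : (fun l => 2 ^ M * (idx (2 * M) (g l) / 2 ^ M) + idx (2 * M) (g l) % 2 ^ M)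
        = fun l => idx (2 * M) (g l) := by funext l; exact Nat.div_add_mod _ _
    rw [this, mem_cube_iff _ _ (fun l => idx_lt _ _)]

lemma Agree.Fspi {π : ℕ → (Fin d → ℕ) → Fin d → ℕ} {s k : ℕ} (hk : 2 * mSeq s < k) {g h : GD d}
    (H : Agree k g h) (hg : g ∈ Fspi π s) : h ∈ Fspi π s := by
  rw [Fspi_iff] at *
  have e : ∀ l, idx (2 * mSeq s) (g l) = idx (2 * mSeq s) (h l) :=
    fun l => idx_congr _ _ _ fun t ht => H l t (by omega)
  simp only [← e]
  rw [← hg]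
  exact (walshD_congr _ k (fun _ => Nat.pow_lt_pow_right (by norm_num) hk) _ _ H).symm

lemma flip_Fspi (π : ℕ → (Fin d → ℕ) → Fin d → ℕ) (s : ℕ) (l0 : Fin d) (g : GD d) :
    flipAt l0 (2 * mSeq s) g ∈ Fspi π s ↔ g ∉ Fspi π s := by
  rw [Fspi_iff, Fspi_iff, walsh_flip]
  have e : ∀ l, idx (2 * mSeq s) (flipAt l0 (2 * mSeq s) g l) = idx (2 * mSeq s) (g l) :=
    fun l => idx_congr _ _ _ fun t ht => flip_agree l0 _ g l t ht
  simp only [e]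
  have h1 := walshD_pm (fun _ => 2 ^ (2 * mSeq s)) g
  unfold walshValD
  generalize cubePoint _ _ = p
  generalize π s _ = q
  rcases walshD_pm q p with h2 | h2 <;> rcases h1 with h1 | h1 <;> rw [h1, h2] <;> norm_num

lemma mSeq_lt (s : ℕ) (hs : 1 ≤ s) : mSeq s < mSeq (s + 1) := by
  rw [mSeq, if_neg (by omega)]; omega

lemma mSeq_strict {s t : ℕ} (hs : 1 ≤ s) (hst : s < t) : mSeq s < mSeq t := by
  induction t with
  | zero => omega
  | succ t ih =>
    rcases Nat.lt_succ_iff_lt_or_eq.1 hst with h | rfl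
    · exact (ih h).trans (mSeq_lt t (by omega))
    · exact mSeq_lt s hs

lemma mSeq_inj {s t : ℕ} (hs : 1 ≤ s) (ht : 1 ≤ t) (h : mSeq s = mSeq t) : s = t := by
  rcases lt_trichotomy s t with h' | h' | h'
  · have := mSeq_strict hs h'; omega
  · exact h'
  · have := mSeq_strict ht h'; omega

/-- points satisfying all constraints visible at rank `k` -/
def Gk (π : ℕ → (Fin d → ℕ) → Fin d → ℕ) (k : ℕ) : Set (GD d) :=
  {g | ∀ s, 1 ≤ s → 2 * mSeq s < k → g ∈ Fspi π s}

lemma Agree.Gk {π : ℕ → (Fin d → ℕ) → Fin d → ℕ} {k : ℕ} {g h : GD d}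
    (H : Agree k g h) (hg : g ∈ Gk π k) : h ∈ Gk π k :=
  fun s hs hk => H.Fspi hk (hg s hs hk)

lemma Gk_mono (π : ℕ → (Fin d → ℕ) → Fin d → ℕ) {j k : ℕ} (h : j ≤ k) : Gk π k ⊆ Gk π j :=
  fun _ hg s hs hk => hg s hs (by omega)

lemma Gk_succ_none (π : ℕ → (Fin d → ℕ) → Fin d → ℕ) {k : ℕ}
    (h : ¬ ∃ s, 1 ≤ s ∧ 2 * mSeq s = k) : Gk π (k + 1) = Gk π k := by
  refine (Gk_mono π (by omega)).antisymm fun g hg s hs hk => hg s hs ?_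
  rcases Nat.lt_succ_iff_lt_or_eq.1 hk with h' | h'
  · exact h'
  · exact absurd ⟨s, hs, h'⟩ h

lemma Gk_succ_some (π : ℕ → (Fin d → ℕ) → Fin d → ℕ) {s : ℕ} (hs : 1 ≤ s) :
    Gk π (2 * mSeq s + 1) = Gk π (2 * mSeq s) ∩ Fspi π s := by
  ext g
  constructor
  · intro h; exact ⟨Gk_mono π (by omega) h, h s hs (by omega)⟩
  · rintro ⟨h, h'⟩ t ht hk
    rcases Nat.lt_succ_iff_lt_or_eq.1 hk with h'' | h''
    · exact h t ht h''
    · rw [mSeq_inj ht hs (by omega)]; exact h'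

lemma isClopen_of_agree (k : ℕ) (A : Set (GD d)) (H : ∀ g h, Agree k g h → g ∈ A → h ∈ A) :
    IsClopen A := by
  let f : GD d → (Fin d → Fin k → ZMod 2) := fun g l t => g l t
  have hf : Continuous f := by fun_prop
  have : A = f ⁻¹' (f '' A) := by
    refine (Set.subset_preimage_image f A).antisymm ?_
    rintro h ⟨g, hg, hgh⟩
    refine H g h (fun l t ht => ?_) hg
    exact congrFun (congrFun hgh l) ⟨t, ht⟩
  rw [this]
  exact (isClopen_discrete _).preimage hf

lemma exists_Fpi (l0 : Fin d) (π : ℕ → (Fin d → ℕ) → Fin d → ℕ) (k : ℕ) (g : GD d)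
    (hg : g ∈ Gk π k) : ∃ h ∈ Fpi π, Agree k g h := by
  let t : ℕ → Set (GD d) := fun i => {h | Agree k g h ∧ h ∈ Gk π (k + i)}
  have hcl : ∀ i, IsClosed (t i) := fun i => by
    refine (isClopen_of_agree (k + i) _ ?_).1
    rintro a b hab ⟨h1, h2⟩
    exact ⟨h1.trans (hab.mono (by omega)), hab.Gk h2⟩
  have hne : ∀ i, (t i).Nonempty := by
    intro i
    induction i with
    | zero => exact ⟨g, fun _ _ _ => rfl, hg⟩
    | succ i ih =>
      obtain ⟨h, h1, h2⟩ := ih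
      by_cases hs : ∃ s, 1 ≤ s ∧ 2 * mSeq s = k + i
      · obtain ⟨s, hs, e⟩ := hs
        by_cases hF : h ∈ Fspi π s
        · refine ⟨h, h1, ?_⟩
          rw [← add_assoc, ← e, Gk_succ_some π hs, e]
          exact ⟨h2, hF⟩
        · have hF' := (flip_Fspi π s l0 h).2 hF
          have ha := (flip_agree l0 (2 * mSeq s) h).symm
          refine ⟨_, h1.trans (ha.mono (by omega)), ?_⟩
          rw [← add_assoc, ← e, Gk_succ_some π hs]
          exact ⟨ha.Gk (e ▸ h2), hF'⟩
      · refine ⟨h, h1, ?_⟩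
        rw [← add_assoc, Gk_succ_none π hs]
        exact h2
  obtain ⟨h, hh⟩ := IsCompact.nonempty_iInter_of_sequence_nonempty_isCompact_isClosed t
    (fun i a ha => ⟨ha.1, Gk_mono π (by omega) ha.2⟩) hne (hcl 0).isCompact hcl
  rw [Set.mem_iInter] at hh
  refine ⟨h, ?_, (hh 0).1⟩
  simp only [Fpi, Set.mem_iInter, Set.mem_Ici]
  intro s hs
  exact (hh (2 * mSeq s + 1)).2 s hs (by omega)

lemma cube_inter_nonempty (l0 : Fin d) (π : ℕ → (Fin d → ℕ) → Fin d → ℕ) (k : ℕ)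
    (m : Fin d → ℕ) : (dyadicCube k m ∩ Fpi π).Nonempty ↔ cubePoint k m ∈ Gk π k := by
  constructor
  · rintro ⟨g, hg, hF⟩
    rw [mem_cube_agree] at hg
    refine hg.Gk fun s hs _ => ?_
    simp only [Fpi, Set.mem_iInter, Set.mem_Ici] at hF
    exact hF s hs
  · intro h
    obtain ⟨g, hg, ha⟩ := exists_Fpi l0 π k _ h
    exact ⟨g, (mem_cube_agree _ _ _).2 ha.symm, hg⟩

/-- number of constraints visible at rank `k` -/
def Nk (k : ℕ) : ℕ := ((Finset.range k).filter fun j => ∃ s, 1 ≤ s ∧ 2 * mSeq s = j).card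

lemma Nk_succ_none {k : ℕ} (h : ¬ ∃ s, 1 ≤ s ∧ 2 * mSeq s = k) : Nk (k + 1) = Nk k := by
  unfold Nk; rw [Finset.range_add_one, Finset.filter_insert, if_neg h]

lemma Nk_succ_some {k : ℕ} (h : ∃ s, 1 ≤ s ∧ 2 * mSeq s = k) : Nk (k + 1) = Nk k + 1 := by
  unfold Nk
  rw [Finset.range_add_one, Finset.filter_insert, if_pos h, Finset.card_insert_of_notMem]
  simp

lemma Nk_mSeq (s : ℕ) (hs : 1 ≤ s) : Nk (2 * mSeq s + 1) = s := by
  unfold Nk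
  have : ((Finset.range (2 * mSeq s + 1)).filter fun j => ∃ s, 1 ≤ s ∧ 2 * mSeq s = j)
      = (Finset.Icc 1 s).image fun t => 2 * mSeq t := by
    ext j
    simp only [Finset.mem_filter, Finset.mem_range, Finset.mem_image, Finset.mem_Icc]
    constructor
    · rintro ⟨hj, t, ht, rfl⟩
      refine ⟨t, ⟨ht, ?_⟩, rfl⟩
      by_contra hc
      have := mSeq_strict hs (not_le.1 hc)
      omega
    · rintro ⟨t, ⟨ht, hts⟩, rfl⟩
      refine ⟨?_, t, ht, rfl⟩
      rcases hts.lt_or_eq with h | rfl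
      · have := mSeq_strict ht h; omega
      · omega
  rw [this, Finset.card_image_of_injOn]
  · simp
  · intro a ha b hb hab
    simp only [Finset.coe_Icc, Set.mem_Icc] at ha hb
    exact mSeq_inj ha.1 hb.1 (by simpa using hab)

def child (m : Fin d → ℕ) (σ : Fin d → Fin 2) : Fin d → ℕ := fun l => 2 * m l + (σ l : ℕ)

lemma child_lt {k : ℕ} {m : Fin d → ℕ} (hm : ∀ l, m l < 2 ^ k) (σ : Fin d → Fin 2) (l : Fin d) :
    child m σ l < 2 ^ (k + 1) := by
  have := hm l
  have := (σ l).2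
  simp only [child, pow_succ]; omega

lemma child_idx {k : ℕ} {m : Fin d → ℕ} (hm : ∀ l, m l < 2 ^ k) (σ : Fin d → Fin 2) (l : Fin d) :
    idx k (cubePoint (k + 1) (child m σ) l) = m l ∧
      (cubePoint (k + 1) (child m σ) l k).val = σ l := by
  have := idx_pt (k + 1) (child m σ l) (child_lt hm σ l)
  simp only [idx] at this
  have h1 := ZMod.val_lt (intervalPoint (k + 1) (child m σ l) k)
  have h2 := (σ l).2
  simp only [cubePoint]
  simp only [child] at *
  omega

lemma child_agree {k : ℕ} {m : Fin d → ℕ} (hm : ∀ l, m l < 2 ^ k) (σ : Fin d → Fin 2) :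
    Agree k (cubePoint (k + 1) (child m σ)) (cubePoint k m) := by
  intro l
  refine agree_of_idx k _ _ ?_
  rw [(child_idx hm σ l).1, cubePoint, idx_pt k _ (hm l)]

def flipσ (l0 : Fin d) (σ : Fin d → Fin 2) : Fin d → Fin 2 := Function.update σ l0 (σ l0 + 1)

lemma flipσ_flipσ (l0 : Fin d) (σ : Fin d → Fin 2) : flipσ l0 (flipσ l0 σ) = σ := by
  funext l
  by_cases h : l = l0
  · subst h
    simp only [flipσ, Function.update_self]
    generalize σ l = a
    revert a; decide
  · simp [flipσ, Function.update_of_ne h]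

lemma child_flip (l0 : Fin d) {k : ℕ} {m : Fin d → ℕ} (hm : ∀ l, m l < 2 ^ k)
    (σ : Fin d → Fin 2) :
    Agree (k + 1) (cubePoint (k + 1) (child m (flipσ l0 σ)))
      (flipAt l0 k (cubePoint (k + 1) (child m σ))) := by
  intro l t ht
  rcases Nat.lt_succ_iff_lt_or_eq.1 ht with h | rfl
  · exact ((child_agree hm _).trans ((child_agree hm σ).symm.trans (flip_agree l0 k _).symm)) l t h
  · have h1 := (child_idx hm σ l).2
    have h2 := (child_idx hm (flipσ l0 σ) l).2
    generalize cubePoint (t + 1) (child m (flipσ l0 σ)) = p at *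
    generalize cubePoint (t + 1) (child m σ) = q at *
    by_cases hl : l = l0
    · subst hl
      simp only [flipAt, flipσ, Function.update_self] at *
      generalize p l t = a at *
      generalize q l t = b at *
      generalize σ l = c at *
      revert a b c; decide
    · simp only [flipAt, flipσ, Function.update_of_ne hl] at *
      exact ZMod.val_injective 2 (h2.trans h1.symm)

lemma card_children (l0 : Fin d) (π : ℕ → (Fin d → ℕ) → Fin d → ℕ) {k : ℕ} {m : Fin d → ℕ}
    (hm : ∀ l, m l < 2 ^ k) (hG : cubePoint k m ∈ Gk π k) :
    (Finset.univ.filter fun σ : Fin d → Fin 2 =>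
      cubePoint (k + 1) (child m σ) ∈ Gk π (k + 1)).card * 2 ^ Nk (k + 1) = 2 ^ d * 2 ^ Nk k := by
  have hc : ∀ σ, cubePoint (k + 1) (child m σ) ∈ Gk π k := fun σ => (child_agree hm σ).symm.Gk hG
  by_cases h : ∃ s, 1 ≤ s ∧ 2 * mSeq s = k
  · rw [Nk_succ_some h]
    obtain ⟨s, hs, rfl⟩ := h
    have e : ∀ σ : Fin d → Fin 2, cubePoint (2 * mSeq s + 1) (child m σ) ∈ Gk π (2 * mSeq s + 1) ↔
        cubePoint (2 * mSeq s + 1) (child m σ) ∈ Fspi π s := fun σ => by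
      rw [Gk_succ_some π hs]; exact ⟨fun h => h.2, fun h => ⟨hc σ, h⟩⟩
    simp only [e]
    set P : (Fin d → Fin 2) → Prop := fun σ => cubePoint (2 * mSeq s + 1) (child m σ) ∈ Fspi π s
      with hP
    have hflip : ∀ σ, P (flipσ l0 σ) ↔ ¬ P σ := fun σ => by
      have ha := child_flip l0 hm σ
      rw [hP]; simp only
      rw [← flip_Fspi π s l0]
      exact ⟨fun h => ha.Fspi (by omega) h, fun h => ha.symm.Fspi (by omega) h⟩
    have h1 : (Finset.univ.filter P).card = (Finset.univ.filter fun σ => ¬ P σ).card := by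
      refine Finset.card_nbij' (flipσ l0) (flipσ l0) ?_ ?_ ?_ ?_
      · intro σ hσ; simp at hσ ⊢; rw [hflip]; simpa using hσ
      · intro σ hσ; simp at hσ ⊢; rw [hflip]; exact hσ
      · intro σ _; exact flipσ_flipσ l0 σ
      · intro σ _; exact flipσ_flipσ l0 σ
    have h2 := Finset.card_filter_add_card_filter_not (s := (Finset.univ : Finset (Fin d → Fin 2))) P
    rw [← h1] at h2
    simp at h2
    rw [← h2]; ring
  · rw [Nk_succ_none h, Gk_succ_none π h]
    simp [hc]

lemma tau_formula (l0 : Fin d) (π : ℕ → (Fin d → ℕ) → Fin d → ℕ) (τ : ℕ → (Fin d → ℕ) → ℂ)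
    (hτ : IsTauOf (Fpi π) τ) (k : ℕ) (m : Fin d → ℕ) (hm : ∀ l, m l < 2 ^ k) :
    τ k m = if cubePoint k m ∈ Gk π k then (2 : ℂ) ^ Nk k / 2 ^ (k * d) else 0 := by
  obtain ⟨-, h0, hz, hdiv⟩ := hτ
  induction k generalizing m with
  | zero =>
    have : m = fun _ => 0 := by funext l; simpa using hm l
    subst this
    rw [h0, if_pos]
    · simp [Nk]
    · intro s _ h; omega
  | succ k ih =>
    split_ifs with hG
    · obtain ⟨m', σ, hm', rfl⟩ : ∃ m' σ, (∀ l, m' l < 2 ^ k) ∧ child m' σ = m := by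
        refine ⟨fun l => m l / 2, fun l => ⟨m l % 2, Nat.mod_lt _ (by norm_num)⟩, fun l => ?_, ?_⟩
        · have := hm l; rw [pow_succ] at this; simp only; omega
        · funext l; simp only [child]; omega
      have hG' : cubePoint k m' ∈ Gk π k :=
        (child_agree hm' σ).Gk (Gk_mono π (by omega) hG)
      have := hdiv k m' hm' ((cube_inter_nonempty l0 π k m').2 hG') σ
      simp only [cube_inter_nonempty l0] at this
      have hcc := card_children l0 π hm' hG'
      have e : ∀ σ : Fin d → Fin 2, (fun l => 2 * m' l + (σ l : ℕ)) = child m' σ := fun _ => rfl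
      simp only [e] at this
      rw [if_pos hG, ih m' hm', if_pos hG'] at this
      rw [this]
      generalize Finset.card _ = c at *
      have hc0 : (c : ℂ) ≠ 0 := by
        intro h
        have h' : c = 0 := by exact_mod_cast h
        rw [h', zero_mul] at hcc
        have : 0 < 2 ^ d * 2 ^ Nk k := by positivity
        omega
      have hcc' : (c : ℂ) * 2 ^ Nk (k + 1) = 2 ^ d * 2 ^ Nk k := by exact_mod_cast hcc
      have e2 : (2 : ℂ) ^ ((k + 1) * d) = 2 ^ (k * d) * 2 ^ d := by rw [← pow_add]; ring_nf
      rw [e2]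
      field_simp
      linear_combination -hcc'
    · rw [hz _ _ hm, ← Set.not_nonempty_iff_eq_empty, cube_inter_nonempty l0]
      exact hG

lemma mem_boxLt (k : ℕ) (m : Fin d → ℕ) :
    m ∈ boxLt (fun _ : Fin d => 2 ^ k) ↔ ∀ l, m l < 2 ^ k := by
  simp [boxLt]

lemma local_succ (τ : ℕ → (Fin d → ℕ) → ℂ) (hτ : IsQuasimeasure τ) (n : Fin d → ℕ) (r k : ℕ)
    (hrk : r ≤ k) (hn : ∀ l, n l < 2 ^ k) (mΔ : Fin d → ℕ) :
    localCoeffAt τ n r mΔ (k + 1) = localCoeffAt τ n r mΔ k := by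
  unfold localCoeffAt
  symm
  have h1 : ∀ m ∈ (boxLt (fun _ : Fin d => 2 ^ k)).filter
      (fun m => dyadicCube k m ⊆ dyadicCube r mΔ),
      (walshValD k n m : ℂ) * τ k m = ∑ σ ∈ (Finset.univ : Finset (Fin d → Fin 2)),
        (walshValD (k + 1) n (child m σ) : ℂ) * τ (k + 1) (child m σ) := by
    intro m hm
    have hm' := (mem_boxLt k m).1 (Finset.mem_filter.1 hm).1
    rw [hτ k m hm', Finset.mul_sum]
    refine Finset.sum_congr rfl fun σ _ => ?_
    unfold walshValD
    rw [walshD_congr n k hn _ _ (child_agree hm' σ)]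
    rfl
  rw [Finset.sum_congr rfl h1, ← Finset.sum_product']
  refine Finset.sum_nbij' (fun p => child p.1 p.2)
    (fun m => (fun l => m l / 2, fun l => ⟨m l % 2, Nat.mod_lt _ (by norm_num)⟩)) ?_ ?_ ?_ ?_ ?_
  · rintro ⟨m, σ⟩ h
    simp only [Finset.mem_product, Finset.mem_filter, mem_boxLt, Finset.mem_univ, and_true] at h ⊢
    refine ⟨child_lt h.1 σ, ?_⟩
    rw [cube_subset_iff (by omega)]
    rw [cube_subset_iff hrk] at h
    exact ((child_agree h.1 σ).symm.mono hrk).mem_cube h.2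
  · intro m h
    simp only [Finset.mem_product, Finset.mem_filter, mem_boxLt, Finset.mem_univ, and_true] at h ⊢
    have hb : ∀ l, m l / 2 < 2 ^ k := fun l => by have := h.1 l; rw [pow_succ] at this; omega
    refine ⟨hb, ?_⟩
    rw [cube_subset_iff hrk]
    rw [cube_subset_iff (by omega)] at h
    have e : child (fun l => m l / 2) (fun l => ⟨m l % 2, Nat.mod_lt _ (by norm_num)⟩) = m := by
      funext l; simp only [child]; omega
    have := child_agree hb (fun l => ⟨m l % 2, Nat.mod_lt _ (by norm_num)⟩)
    rw [e] at this
    exact (this.mono hrk).mem_cube h.2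
  · rintro ⟨m, σ⟩ h
    have := fun l => (σ l).2
    refine Prod.ext ?_ ?_
    · funext l; have := this l; simp only [child]; omega
    · funext l; have := this l; apply Fin.ext; simp only [child]; omega
  · intro m h
    funext l; simp only [child]; omega
  · rintro ⟨m, σ⟩ h; rfl

lemma local_const (τ : ℕ → (Fin d → ℕ) → ℂ) (hτ : IsQuasimeasure τ) (n : Fin d → ℕ) (r j k : ℕ)
    (hrj : r ≤ j) (hjk : j ≤ k) (hn : ∀ l, n l < 2 ^ j) (mΔ : Fin d → ℕ) :
    localCoeffAt τ n r mΔ k = localCoeffAt τ n r mΔ j := by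
  induction k, hjk using Nat.le_induction with
  | base => rfl
  | succ k hk ih =>
    rw [local_succ τ hτ n r k (by omega)
      (fun l => (hn l).trans_le (Nat.pow_le_pow_right (by norm_num) hk)), ih]

lemma cube_meas (k : ℕ) (m : Fin d → ℕ) : MeasurableSet (dyadicCube (d := d) k m) :=
  (isClopen_of_agree k _ fun _ _ h hg => h.mem_cube hg).1.measurableSet

lemma cube_disj (k : ℕ) {m m' : Fin d → ℕ} (hm : ∀ l, m l < 2 ^ k) (hm' : ∀ l, m' l < 2 ^ k)
    (h : m ≠ m') : Disjoint (dyadicCube (d := d) k m) (dyadicCube k m') := by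
  rw [Set.disjoint_left]
  intro g hg hg'
  rw [mem_cube_iff _ _ hm] at hg
  rw [mem_cube_iff _ _ hm'] at hg'
  exact h (hg.symm.trans hg')

lemma cube_measure (μ : Measure (GD d)) [μ.IsAddHaarMeasure] (hμ : μ Set.univ = 1) (k : ℕ)
    (m : Fin d → ℕ) (hm : ∀ l, m l < 2 ^ k) :
    μ.real (dyadicCube k m) = 1 / 2 ^ (k * d) := by
  have htr : ∀ m' : Fin d → ℕ, μ (dyadicCube k m') = μ (dyadicCube k m) := by
    intro m'
    rw [← measure_preimage_add μ (cubePoint k m' - cubePoint k m) (dyadicCube k m')]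
    congr 1
    ext g
    rw [Set.mem_preimage, mem_cube_agree, mem_cube_agree]
    unfold Agree
    refine forall_congr' fun l => forall_congr' fun t => forall_congr' fun _ => ?_
    simp only [Pi.add_apply, Pi.sub_apply]
    constructor
    · intro h; linear_combination h
    · intro h; linear_combination h
  have hsum : (1 : ENNReal) = ∑ m' ∈ boxLt (fun _ : Fin d => 2 ^ k), μ (dyadicCube k m') := by
    rw [← measure_biUnion_finset, ← hμ]
    · congr 1
      symm
      rw [Set.eq_univ_iff_forall]
      intro g
      rw [Set.mem_iUnion₂]
      exact ⟨_, (mem_boxLt k _).2 fun l => idx_lt k (g l),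
        (mem_cube_iff k _ (fun l => idx_lt k (g l)) g).2 rfl⟩
    · intro a ha b hb hab
      exact cube_disj k ((mem_boxLt k a).1 ha) ((mem_boxLt k b).1 hb) hab
    · intro b _; exact cube_meas k b
  rw [Finset.sum_congr rfl (fun m' _ => htr m'), Finset.sum_const] at hsum
  have hcard : (boxLt (fun _ : Fin d => 2 ^ k)).card = 2 ^ (k * d) := by
    simp [boxLt, pow_mul]
  rw [hcard] at hsum
  have := congrArg ENNReal.toReal hsum
  simp at this
  rw [eq_div_iff (by positivity), this, Measure.real]
  ring

end Aux

theorem statement13 (d : ℕ) (hd : 2 ≤ d)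
    (μ : Measure (GD d)) [μ.IsAddHaarMeasure] (hμ : μ Set.univ = 1)
    (π : PermSeq d) (τ : ℕ → (Fin d → ℕ) → ℂ) (hτ : IsTauOf (Fpi π.f) τ)
    (s : ℕ) (hs : 1 ≤ s) (n : Fin d → ℕ) (hn : ∀ l, n l < 2 ^ (2 * mSeq s + 1))
    (mΔ : Fin d → ℕ) (hmΔ : ∀ l, mΔ l < 2 ^ mSeq s)
    (hsub : dyadicCube (mSeq s) mΔ ⊆ Ftil π.f (s - 1)) :
    ∀ k : ℕ, (∀ l, n l < 2 ^ k) → mSeq s ≤ k →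
      (∫ g in Fspi π.f s ∩ dyadicCube (mSeq s) mΔ, (walshD n g : ℂ) ∂μ)
        = (2 : ℂ)⁻¹ ^ s * localCoeffAt τ n (mSeq s) mΔ k := by
  intro k hk hmk
  have l0 : Fin d := ⟨0, by omega⟩
  haveI : IsFiniteMeasure μ := ⟨by rw [hμ]; exact ENNReal.one_lt_top⟩
  set K := 2 * mSeq s + 1 with hK
  have hrK : mSeq s ≤ K := by omega
  -- pass to resolution `K`
  have hlc : localCoeffAt τ n (mSeq s) mΔ k = localCoeffAt τ n (mSeq s) mΔ K := by
    rcases le_total k K with h | h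
    · exact (local_const τ hτ.1 n _ k K hmk h hk mΔ).symm
    · exact local_const τ hτ.1 n _ K k hrK h hn mΔ
  rw [hlc]
  have hGF : ∀ g ∈ dyadicCube (mSeq s) mΔ, (g ∈ Gk π.f K ↔ g ∈ Fspi π.f s) := by
    intro g hg
    refine ⟨fun h => h s hs (by omega), fun h => ?_⟩
    rw [hK, Gk_succ_some _ hs]
    refine ⟨fun t ht htk => ?_, h⟩
    have h1 := hsub hg
    simp only [Ftil, Set.mem_iInter, Finset.mem_Icc] at h1
    refine h1 t ⟨ht, ?_⟩
    by_contra hc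
    have hst : s ≤ t := by omega
    rcases hst.lt_or_eq with h' | rfl
    · have := mSeq_strict hs h'; omega
    · omega
  set T := (boxLt (fun _ : Fin d => 2 ^ K)).filter fun m =>
    cubePoint K m ∈ Fspi π.f s ∩ dyadicCube (mSeq s) mΔ with hT
  have hdep : ∀ g h, Agree K g h → g ∈ Fspi π.f s ∩ dyadicCube (mSeq s) mΔ →
      h ∈ Fspi π.f s ∩ dyadicCube (mSeq s) mΔ := fun g h H hg =>
    ⟨H.Fspi (by omega) hg.1, (H.mono hrK).mem_cube hg.2⟩
  have hU : Fspi π.f s ∩ dyadicCube (mSeq s) mΔ = ⋃ m ∈ T, dyadicCube K m := by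
    ext g
    rw [Set.mem_iUnion₂]
    constructor
    · intro hg
      have hb : ∀ l, idx K (g l) < 2 ^ K := fun l => idx_lt K (g l)
      have hc := (mem_cube_iff K _ hb g).2 rfl
      refine ⟨_, Finset.mem_filter.2 ⟨(mem_boxLt K _).2 hb, ?_⟩, hc⟩
      exact hdep _ _ ((mem_cube_agree _ _ _).1 hc) hg
    · rintro ⟨m, hm, hg⟩
      exact hdep _ _ ((mem_cube_agree _ _ _).1 hg).symm (Finset.mem_filter.1 hm).2
  have hconst : ∀ m, Set.EqOn (fun g => (walshD n g : ℂ)) (fun _ => (walshValD K n m : ℂ))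
      (dyadicCube K m) := fun m g hg => by
    simp only [walshValD]
    rw [walshD_congr n K hn _ _ ((mem_cube_agree _ _ _).1 hg)]
  have hint : ∫ g in Fspi π.f s ∩ dyadicCube (mSeq s) mΔ, (walshD n g : ℂ) ∂μ
      = ∑ m ∈ T, (walshValD K n m : ℂ) * (1 / 2 ^ (K * d)) := by
    rw [hU, integral_biUnion_finset]
    · refine Finset.sum_congr rfl fun m hm => ?_
      rw [setIntegral_congr_fun (cube_meas K m) (hconst m), setIntegral_const,
        cube_measure μ hμ K m ((mem_boxLt K m).1 (Finset.mem_filter.1 hm).1)]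
      rw [Complex.real_smul, mul_comm]
      push_cast
      rfl
    · intro m _; exact cube_meas K m
    · intro a ha b hb hab
      exact cube_disj K ((mem_boxLt K a).1 (Finset.mem_filter.1 ha).1)
        ((mem_boxLt K b).1 (Finset.mem_filter.1 hb).1) hab
    · intro m _
      exact (integrableOn_congr_fun (hconst m) (cube_meas K m)).2 (integrable_const _).integrableOn
  rw [hint]
  unfold localCoeffAt
  have hT' : T = ((boxLt (fun _ : Fin d => 2 ^ K)).filter
      (fun m => dyadicCube K m ⊆ dyadicCube (mSeq s) mΔ)).filter
        (fun m => cubePoint K m ∈ Gk π.f K) := by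
    ext m
    simp only [hT, Finset.mem_filter, Set.mem_inter_iff, cube_subset_iff hrK]
    constructor
    · rintro ⟨h1, h2, h3⟩; exact ⟨⟨h1, h3⟩, (hGF _ h3).2 h2⟩
    · rintro ⟨⟨h1, h3⟩, h2⟩; exact ⟨h1, (hGF _ h3).1 h2, h3⟩
  rw [hT', Finset.sum_filter, Finset.mul_sum]
  refine Finset.sum_congr rfl fun m hm => ?_
  rw [tau_formula l0 π.f τ hτ K m ((mem_boxLt K m).1 (Finset.mem_filter.1 hm).1)]
  split_ifs
  · rw [hK, Nk_mSeq s hs, inv_pow]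
    field_simp
  · simp
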